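/- Assume (A3). The residual plane SA(p,K) satisfies the parallelogram condition (Pgm): for pairwise distinct x, y, z ∈ P ∖ p̄ there exists a point w ∈ P ∖ p̄ with x⊔y ∥ z⊔w and x⊔z ∥ y⊔w. -/

import Mathlib

/-- A Laguerre plane: points, circles, and a parallelity relation. -/
structure LaguerrePlane (P : Type*) where
  Circles : Set (Set P)
  Par : P → P → Prop
  par_equiv : Equivalence Par
  joinCircle : ∀ a b c : P, ¬ Par a b → ¬ Par b c → ¬ Par a c →
    ∃! C, C ∈ Circles ∧ a ∈ C ∧ b ∈ C ∧ c ∈ C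
  touching : ∀ K ∈ Circles, ∀ p ∈ K, ∀ q, q ∉ K → ¬ Par p q →
    ∃! C, C ∈ Circles ∧ q ∈ C ∧ K ∩ C = {p}
  parPoint : ∀ (x : P), ∀ K ∈ Circles, ∃! q, Par x q ∧ q ∈ K
  nontriv : ∃ C ∈ Circles,
    (∃ a b c : P, a ∈ C ∧ b ∈ C ∧ c ∈ C ∧ a ≠ b ∧ b ≠ c ∧ a ≠ c) ∧ C ≠ Set.univ

namespace LaguerrePlane

variable {P : Type*}

/-- The generator (parallel class) of a point. -/
def gen (L : LaguerrePlane P) (p : P) : Set P := {q | L.Par p q}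

/-- The pencil ⟨p,K⟩: the circle K together with all circles tangent to K at p. -/
def pencil (L : LaguerrePlane P) (p : P) (K : Set P) : Set (Set P) :=
  insert K {M | M ∈ L.Circles ∧ M ∩ K = {p}}

/-- An automorphism of a Laguerre plane: a bijection of the points mapping
circles onto circles and preserving parallelity. -/
def IsAut (L : LaguerrePlane P) (σ : Equiv.Perm P) : Prop :=
  (∀ C, C ∈ L.Circles ↔ ⇑σ '' C ∈ L.Circles) ∧
  (∀ x y, L.Par x y ↔ L.Par (σ x) (σ y))

/-- The line x ⊔ y of the residual plane SA(p,K):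
{x} together with the orbit of y under the stabilizer of x in Δ. -/
def line (Δ : Subgroup (Equiv.Perm P)) (x y : P) : Set P :=
  {x} ∪ {z | ∃ σ ∈ Δ, σ x = x ∧ σ y = z}

/-- Parallelity of lines of the residual plane SA(p,K). -/
def LinePar (Δ : Subgroup (Equiv.Perm P)) (A B : Set P) : Prop :=
  ∃ σ ∈ Δ, ⇑σ '' A = B

end LaguerrePlane

open LaguerrePlane

namespace LaguerrePlane

section Basic

variable {P : Type*} (L : LaguerrePlane P)

theorem par_refl (a : P) : L.Par a a := L.par_equiv.refl a

variable {L}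

theorem par_symm {a b : P} (h : L.Par a b) : L.Par b a := L.par_equiv.symm h

theorem par_trans {a b c : P} (h : L.Par a b) (h' : L.Par b c) : L.Par a c :=
  L.par_equiv.trans h h'

theorem not_par_of_par {a b c : P} (h : ¬ L.Par a b) (h' : L.Par b c) : ¬ L.Par a c :=
  fun h'' => h (par_trans h'' (par_symm h'))

theorem ne_of_not_par {a b : P} (h : ¬ L.Par a b) : a ≠ b :=
  fun h' => h (h' ▸ L.par_refl a)

theorem eq_of_par {C : Set P} (hC : C ∈ L.Circles) {a b : P} (ha : a ∈ C) (hb : b ∈ C)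
    (h : L.Par a b) : a = b :=
  (L.parPoint a C hC).unique ⟨L.par_refl a, ha⟩ ⟨h, hb⟩

theorem exists_par_mem {C : Set P} (hC : C ∈ L.Circles) (a : P) : ∃ b, L.Par a b ∧ b ∈ C :=
  (L.parPoint a C hC).exists

theorem circle_ext {C D : Set P} (hC : C ∈ L.Circles) (hD : D ∈ L.Circles) {a b c : P}
    (hab : a ≠ b) (hbc : b ≠ c) (hac : a ≠ c) (haC : a ∈ C) (hbC : b ∈ C) (hcC : c ∈ C)
    (haD : a ∈ D) (hbD : b ∈ D) (hcD : c ∈ D) : C = D :=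
  (L.joinCircle a b c (fun h => hab (eq_of_par hC haC hbC h))
    (fun h => hbc (eq_of_par hC hbC hcC h)) (fun h => hac (eq_of_par hC haC hcC h))).unique
    ⟨hC, haC, hbC, hcC⟩ ⟨hD, haD, hbD, hcD⟩

theorem touching_ext {K C D : Set P} (hK : K ∈ L.Circles) {a b : P} (hbK : b ∉ K)
    (hC : C ∈ L.Circles) (hD : D ∈ L.Circles) (hbC : b ∈ C) (hbD : b ∈ D)
    (hKC : K ∩ C = {a}) (hKD : K ∩ D = {a}) : C = D := by
  have ha : a ∈ K ∩ C := hKC ▸ rfl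
  refine (L.touching K hK a ha.1 b hbK fun h => hbK ?_).unique ⟨hC, hbC, hKC⟩ ⟨hD, hbD, hKD⟩
  exact eq_of_par hC ha.2 hbC h ▸ ha.1

/-- There is a generator different from two given ones. -/
theorem exists_not_par (L : LaguerrePlane P) (a b : P) : ∃ c, ¬ L.Par a c ∧ ¬ L.Par b c := by
  obtain ⟨C, hC, ⟨x, y, z, hx, hy, hz, hxy, hyz, hxz⟩, -⟩ := L.nontriv
  have key : ∀ {d u v : P}, u ∈ C → v ∈ C → L.Par d u → L.Par d v → u = v :=
    fun hu hv h h' => eq_of_par hC hu hv (par_trans (par_symm h) h')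
  by_contra! H
  by_cases h1 : L.Par a x <;> by_cases h2 : L.Par a y <;> by_cases h3 : L.Par a z
  all_goals first
    | exact hxy (key hx hy h1 h2)
    | exact hxz (key hx hz h1 h3)
    | exact hyz (key hy hz h2 h3)
    | exact hxy (key hx hy (H _ h1) (H _ h2))
    | exact hxz (key hx hz (H _ h1) (H _ h3))
    | exact hyz (key hy hz (H _ h2) (H _ h3))

end Basic

/-- A group `Δ` acting on the residual plane of a Laguerre plane at the flag `(p, K)`. -/
structure IsResidual {P : Type*} (L : LaguerrePlane P) (p : P) (K : Set P)
    (Δ : Subgroup (Equiv.Perm P)) : Prop where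
  circle_mem : K ∈ L.Circles
  base_mem : p ∈ K
  aut : ∀ σ ∈ Δ, L.IsAut σ
  fix : ∀ σ ∈ Δ, ∀ q, L.Par p q → σ q = q
  pencil_image : ∀ σ ∈ Δ, ∀ M ∈ L.pencil p K, ⇑σ '' M ∈ L.pencil p K
  trans : ∀ x y : P, ¬ L.Par p x → ¬ L.Par p y → ∃ σ ∈ Δ, σ x = y
  trans_stab : ∀ r ∈ K, r ≠ p → ∀ x ∈ K, x ≠ p → x ≠ r → ∀ y ∈ K, y ≠ p → y ≠ r →
    ∃ σ ∈ Δ, σ r = r ∧ σ x = y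
  vertex : ∀ M ∈ L.Circles, p ∉ M → ∃! N, N ∈ L.pencil p K ∧ ∃ z, M ∩ N = {z}

/-- The circle of the pencil `⟨p, K⟩` through `x`. -/
def level {P : Type*} (L : LaguerrePlane P) (p : P) (K : Set P) (x : P) : Set P :=
  {y | ∃ N ∈ L.pencil p K, x ∈ N ∧ y ∈ N}

namespace IsResidual

variable {P : Type*} {L : LaguerrePlane P} {p : P} {K : Set P} {Δ : Subgroup (Equiv.Perm P)}
  (R : L.IsResidual p K Δ)

include R

theorem par_map {σ : Equiv.Perm P} (hσ : σ ∈ Δ) {a b : P} : L.Par (σ a) (σ b) ↔ L.Par a b :=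
  ((R.aut σ hσ).2 a b).symm

theorem map_base {σ : Equiv.Perm P} (hσ : σ ∈ Δ) : σ p = p := R.fix σ hσ p (L.par_refl p)

theorem par_base_map {σ : Equiv.Perm P} (hσ : σ ∈ Δ) {a : P} : L.Par p (σ a) ↔ L.Par p a := by
  conv_lhs => rw [← R.map_base hσ]
  exact R.par_map hσ

theorem image_circle {σ : Equiv.Perm P} (hσ : σ ∈ Δ) {C : Set P} (hC : C ∈ L.Circles) :
    ⇑σ '' C ∈ L.Circles :=
  ((R.aut σ hσ).1 C).1 hC

theorem pencil_circle {N : Set P} (hN : N ∈ L.pencil p K) : N ∈ L.Circles := by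
  rcases hN with rfl | hN
  exacts [R.circle_mem, hN.1]

theorem base_mem_pencil {N : Set P} (hN : N ∈ L.pencil p K) : p ∈ N := by
  rcases hN with rfl | hN
  · exact R.base_mem
  · exact (hN.2 ▸ rfl : p ∈ N ∩ K).1

theorem pencil_ext {N M : Set P} (hN : N ∈ L.pencil p K) (hM : M ∈ L.pencil p K) {x : P}
    (hx : ¬ L.Par p x) (hxN : x ∈ N) (hxM : x ∈ M) : N = M := by
  have key : ∀ {u : P} {N : Set P}, ¬ L.Par p u → N ∩ K = {p} → u ∈ N → u ∉ K := by
    intro u N hu h huN huK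
    have : u ∈ N ∩ K := ⟨huN, huK⟩
    rw [h] at this
    exact hu (this ▸ L.par_refl p)
  rcases hN with rfl | hN <;> rcases hM with rfl | hM
  · rfl
  · exact absurd hxN (key hx hM.2 hxM)
  · exact absurd hxM (key hx hN.2 hxN)
  · exact touching_ext R.circle_mem (key hx hN.2 hxN) hN.1 hM.1 hxN hxM
      (by rw [Set.inter_comm, hN.2]) (by rw [Set.inter_comm, hM.2])

theorem exists_pencil {x : P} (hx : ¬ L.Par p x) : ∃ N ∈ L.pencil p K, x ∈ N := by
  by_cases h : x ∈ K
  · exact ⟨K, Set.mem_insert _ _, h⟩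
  · obtain ⟨C, ⟨hC, hxC, hKC⟩, -⟩ := L.touching K R.circle_mem p R.base_mem x h hx
    exact ⟨C, Or.inr ⟨hC, by rw [Set.inter_comm, hKC]⟩, hxC⟩

theorem level_eq {x : P} (hx : ¬ L.Par p x) {N : Set P} (hN : N ∈ L.pencil p K) (hxN : x ∈ N) :
    L.level p K x = N := by
  ext y
  constructor
  · rintro ⟨M, hM, hxM, hyM⟩
    rwa [R.pencil_ext hN hM hx hxN hxM]
  · exact fun hy => ⟨N, hN, hxN, hy⟩

theorem level_mem_pencil {x : P} (hx : ¬ L.Par p x) : L.level p K x ∈ L.pencil p K := by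
  obtain ⟨N, hN, hxN⟩ := R.exists_pencil hx
  rwa [R.level_eq hx hN hxN]

theorem level_circle {x : P} (hx : ¬ L.Par p x) : L.level p K x ∈ L.Circles :=
  R.pencil_circle (R.level_mem_pencil hx)

theorem base_mem_level {x : P} (hx : ¬ L.Par p x) : p ∈ L.level p K x :=
  R.base_mem_pencil (R.level_mem_pencil hx)

theorem self_mem_level {x : P} (hx : ¬ L.Par p x) : x ∈ L.level p K x := by
  obtain ⟨N, hN, hxN⟩ := R.exists_pencil hx
  rwa [R.level_eq hx hN hxN]

theorem level_eq_level {x y : P} (hx : ¬ L.Par p x) (hy : ¬ L.Par p y)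
    (h : y ∈ L.level p K x) : L.level p K y = L.level p K x :=
  R.level_eq hy (R.level_mem_pencil hx) h

theorem image_level {σ : Equiv.Perm P} (hσ : σ ∈ Δ) {x : P} (hx : ¬ L.Par p x) :
    ⇑σ '' L.level p K x = L.level p K (σ x) :=
  (R.level_eq (by rwa [R.par_base_map hσ]) (R.pencil_image σ hσ _ (R.level_mem_pencil hx))
    (Set.mem_image_of_mem _ (R.self_mem_level hx))).symm

theorem map_mem_level {σ : Equiv.Perm P} (hσ : σ ∈ Δ) {x y : P} (hx : ¬ L.Par p x)
    (hy : y ∈ L.level p K x) : σ y ∈ L.level p K (σ x) :=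
  R.image_level hσ hx ▸ Set.mem_image_of_mem _ hy

/-- Levels and generators coordinatize the residual plane. -/
theorem eq_of_par_of_mem_level {x y : P} (hx : ¬ L.Par p x) (h : L.Par x y)
    (hy : y ∈ L.level p K x) : y = x :=
  (eq_of_par (R.level_circle hx) (R.self_mem_level hx) hy h).symm

theorem eq_one {σ : Equiv.Perm P} (hσ : σ ∈ Δ) (h : ∀ u, ¬ L.Par p u → σ u = u) : σ = 1 := by
  ext u
  by_cases hu : L.Par p u
  · simpa using R.fix σ hσ u hu
  · simpa using h u hu

theorem exists_par_not_mem_level {x y : P} (hx : ¬ L.Par p x) (hy : ¬ L.Par p y)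
    (hxy : ¬ L.Par x y) : ∃ z, L.Par y z ∧ z ∉ L.level p K x := by
  by_cases hp : ∃ q, L.Par p q ∧ q ≠ p
  · obtain ⟨q, hpq, hqp⟩ := hp
    have hq : q ∉ L.level p K x := fun h =>
      hqp (eq_of_par (R.level_circle hx) (R.base_mem_level hx) h hpq).symm
    obtain ⟨M, ⟨hM, -, hMx⟩, -⟩ := L.touching _ (R.level_circle hx) x (R.self_mem_level hx) q hq
      fun h => hx (par_trans hpq (par_symm h))
    obtain ⟨z, hyz, hzM⟩ := exists_par_mem hM y
    refine ⟨z, hyz, fun h => hxy ?_⟩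
    have : z ∈ L.level p K x ∩ M := ⟨h, hzM⟩
    rw [hMx] at this
    exact this ▸ par_symm hyz
  · push Not at hp
    obtain ⟨C, hC, -, hCu⟩ := L.nontriv
    obtain ⟨d, hd⟩ := (Set.ne_univ_iff_exists_notMem C).1 hCu
    obtain ⟨e, hde, heC⟩ := exists_par_mem hC d
    have hpd : ¬ L.Par p d := fun h => hd (by
      rwa [hp d h, ← hp e (par_trans h hde)])
    obtain ⟨σ, hσ, rfl⟩ := R.trans d y hpd hy
    by_cases h : σ d ∈ L.level p K x
    · refine ⟨σ e, (R.par_map hσ).2 hde, fun h' => hd ?_⟩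
      rwa [σ.injective (eq_of_par (R.level_circle hx) h h' ((R.par_map hσ).2 hde))]
    · exact ⟨_, L.par_refl _, h⟩

theorem exists_not_par_not_mem_level {x : P} (hx : ¬ L.Par p x) :
    ∃ y, ¬ L.Par p y ∧ ¬ L.Par x y ∧ y ∉ L.level p K x := by
  obtain ⟨y, hy, hxy⟩ := L.exists_not_par p x
  obtain ⟨z, hyz, hz⟩ := R.exists_par_not_mem_level hx hy hxy
  exact ⟨z, not_par_of_par hy hyz, fun h => hxy (par_trans h (par_symm hyz)), hz⟩

theorem exists_touching {x y : P} (hx : ¬ L.Par p x) (hxy : ¬ L.Par x y)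
    (hyx : y ∉ L.level p K x) : ∃ M ∈ L.Circles, y ∈ M ∧ L.level p K x ∩ M = {x} := by
  obtain ⟨M, ⟨hM, hyM, h⟩, -⟩ :=
    L.touching _ (R.level_circle hx) x (R.self_mem_level hx) y hyx hxy
  exact ⟨M, hM, hyM, h⟩

theorem base_not_mem {x : P} (hx : ¬ L.Par p x) {M : Set P} (h : L.level p K x ∩ M = {x}) :
    p ∉ M := by
  intro hp
  have : p ∈ L.level p K x ∩ M := ⟨R.base_mem_level hx, hp⟩
  rw [h] at this
  exact hx (this ▸ L.par_refl p)

/-- The stabilizer of `x` leaves every circle touching the level of `x` at `x` invariant. -/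
theorem map_mem_of_touching {σ : Equiv.Perm P} (hσ : σ ∈ Δ) {x : P} (hx : ¬ L.Par p x)
    (hσx : σ x = x) {M : Set P} (hM : M ∈ L.Circles) (hMx : L.level p K x ∩ M = {x}) {u : P}
    (hu : u ∈ M) : σ u ∈ M := by
  obtain ⟨q, hpq, hq⟩ := exists_par_mem hM p
  have hql : q ∉ L.level p K x := fun h => R.base_not_mem hx hMx
    ((eq_of_par (R.level_circle hx) (R.base_mem_level hx) h hpq) ▸ hq)
  have h : ⇑σ '' M = M := by
    refine touching_ext (R.level_circle hx) hql (R.image_circle hσ hM) hM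
      ⟨q, hq, R.fix σ hσ q hpq⟩ hq ?_ hMx
    conv_lhs => rw [← hσx]
    rw [← R.image_level hσ hx, ← Set.image_inter σ.injective, hMx, Set.image_singleton, hσx]
  exact h ▸ Set.mem_image_of_mem _ hu

/-- The stabilizer of `x` is transitive on the generators different from those of `p` and `x`. -/
theorem exists_stab_par {x y z : P} (hx : ¬ L.Par p x) (hy : ¬ L.Par p y) (hz : ¬ L.Par p z)
    (hxy : ¬ L.Par x y) (hxz : ¬ L.Par x z) : ∃ σ ∈ Δ, σ x = x ∧ L.Par (σ y) z := by
  obtain ⟨k, hxk, hkK⟩ := exists_par_mem R.circle_mem x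
  have hk : ¬ L.Par p k := not_par_of_par hx hxk
  obtain ⟨g, hg, rfl⟩ := R.trans x k hx hk
  obtain ⟨y', hyy', hy'⟩ := exists_par_mem (R.level_circle hx) y
  obtain ⟨z', hzz', hz'⟩ := exists_par_mem (R.level_circle hx) z
  have hKl : L.level p K (g x) = K := R.level_eq hk (Set.mem_insert _ _) hkK
  have key : ∀ {u v : P}, ¬ L.Par p u → ¬ L.Par x u → L.Par u v → g v ≠ p ∧ g v ≠ g x := by
    refine fun hu hxu huv => ⟨fun h => ?_, fun h => ?_⟩
    · exact not_par_of_par hu huv ((R.par_base_map hg).1 (by rw [h]; exact L.par_refl p))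
    · exact hxu (by rw [← g.injective h]; exact par_symm huv)
  obtain ⟨τ, hτ, hτx, hτy⟩ := R.trans_stab (g x) hkK (fun h => hk (by rw [h]; exact L.par_refl p))
    (g y') (hKl ▸ R.map_mem_level hg hx hy') (key hy hxy hyy').1 (key hy hxy hyy').2
    (g z') (hKl ▸ R.map_mem_level hg hx hz') (key hz hxz hzz').1 (key hz hxz hzz').2
  have hmem : g⁻¹ * τ * g ∈ Δ := Δ.mul_mem (Δ.mul_mem (Δ.inv_mem hg) hτ) hg
  refine ⟨g⁻¹ * τ * g, hmem, by simp [hτx], ?_⟩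
  have h1 : (g⁻¹ * τ * g) y' = z' := by simp [hτy]
  have h2 := (R.par_map hmem).2 hyy'
  rw [h1] at h2
  exact par_trans h2 (par_symm hzz')

/-- An element of `Δ` that fixes a point and another generator is trivial. -/
theorem eq_one_of_fix {σ : Equiv.Perm P} (hσ : σ ∈ Δ) {x y : P} (hx : ¬ L.Par p x)
    (hy : ¬ L.Par p y) (hxy : ¬ L.Par x y) (hσx : σ x = x) (hσy : L.Par y (σ y)) : σ = 1 := by
  have hfix : ∀ u, L.Par y u → σ u = u := by
    intro u hyu
    have hu : L.Par u (σ u) :=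
      par_trans (par_symm hyu) (par_trans hσy ((R.par_map hσ).2 hyu))
    have hpu := not_par_of_par hy hyu
    by_cases h : u ∈ L.level p K x
    · have := R.map_mem_level hσ hx h
      rw [hσx] at this
      exact (eq_of_par (R.level_circle hx) h this hu).symm
    · obtain ⟨M, hM, huM, hMx⟩ :=
        R.exists_touching hx (fun h' => hxy (par_trans h' (par_symm hyu))) h
      exact (eq_of_par hM huM (R.map_mem_of_touching hσ hx hσx hM hMx huM) hu).symm
  have hlev : ∀ u, ¬ L.Par p u → σ u ∈ L.level p K u := by
    intro u hu
    obtain ⟨v, hyv, hv⟩ := exists_par_mem (R.level_circle hu) y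
    have hpv := not_par_of_par hy hyv
    have he := R.level_eq_level hu hpv hv
    rw [← he]
    have := R.map_mem_level hσ hpv (he.symm ▸ R.self_mem_level hu)
    rwa [hfix v hyv] at this
  obtain ⟨z, hyz, hz⟩ := R.exists_par_not_mem_level hx hy hxy
  have hpz := not_par_of_par hy hyz
  have hxz : ¬ L.Par x z := fun h => hxy (par_trans h (par_symm hyz))
  obtain ⟨S, ⟨hS, hpS, hxS, hzS⟩, -⟩ := L.joinCircle p x z hx hxz hpz
  have hσS : ⇑σ '' S = S :=
    circle_ext (R.image_circle hσ hS) hS (a := p) (b := x) (c := z)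
      (fun h => hx (h ▸ L.par_refl p)) (fun h => hxz (h ▸ L.par_refl x))
      (fun h => hpz (h ▸ L.par_refl p)) ⟨p, hpS, R.map_base hσ⟩ ⟨x, hxS, hσx⟩
      ⟨z, hzS, hfix z hyz⟩ hpS hxS hzS
  refine R.eq_one hσ fun u hu => ?_
  obtain ⟨g, hug, hgS⟩ := exists_par_mem hS u
  have hpg := not_par_of_par hu hug
  have hσg : σ g = g := by
    by_contra hne
    have h1 : σ g ∈ S := hσS ▸ Set.mem_image_of_mem _ hgS
    have h2 : S = L.level p K g :=
      circle_ext hS (R.level_circle hpg) (a := p) (b := g) (c := σ g)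
        (fun h => hpg (h ▸ L.par_refl p)) (Ne.symm hne)
        (fun h => hpg ((R.par_base_map hσ).1 (h ▸ L.par_refl p)))
        hpS hgS h1 (R.base_mem_level hpg) (R.self_mem_level hpg) (hlev g hpg)
    have h3 : L.level p K x = S := by
      rw [h2] at hxS ⊢
      exact R.level_eq_level hpg hx hxS
    exact hz (h3 ▸ hzS)
  refine R.eq_of_par_of_mem_level hu ?_ (hlev u hu)
  have := (R.par_map hσ).2 hug
  rw [hσg] at this
  exact par_trans hug (par_symm this)

theorem mem_level_symm {x y : P} (hx : ¬ L.Par p x) (hy : ¬ L.Par p y)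
    (h : y ∈ L.level p K x) : x ∈ L.level p K y :=
  (R.level_eq_level hx hy h).symm ▸ R.self_mem_level hx

theorem map_mem_of_three {σ : Equiv.Perm P} (hσ : σ ∈ Δ) {C : Set P} (hC : C ∈ L.Circles)
    {a b c : P} (hab : a ≠ b) (hbc : b ≠ c) (hac : a ≠ c) (ha : a ∈ C) (hb : b ∈ C) (hc : c ∈ C)
    (hσa : σ a ∈ C) (hσb : σ b ∈ C) (hσc : σ c ∈ C) {u : P} (hu : u ∈ C) : σ u ∈ C := by
  have h : ⇑σ '' C = C :=
    circle_ext (R.image_circle hσ hC) hC (σ.injective.ne hab) (σ.injective.ne hbc)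
      (σ.injective.ne hac) ⟨a, ha, rfl⟩ ⟨b, hb, rfl⟩ ⟨c, hc, rfl⟩ hσa hσb hσc
  exact h ▸ Set.mem_image_of_mem _ hu

/-- A circle off the base point meets every level in at most two points. -/
theorem eq_or_eq_of_mem_level {C : Set P} (hC : C ∈ L.Circles) (hpC : p ∉ C) {a b c u : P}
    (hu : ¬ L.Par p u) (hab : a ≠ b) (ha : a ∈ C) (hb : b ∈ C) (hc : c ∈ C)
    (hau : a ∈ L.level p K u) (hbu : b ∈ L.level p K u) (hcu : c ∈ L.level p K u) :
    c = a ∨ c = b := by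
  by_contra! h
  refine hpC ?_
  rw [circle_ext hC (R.level_circle hu) hab h.2.symm h.1.symm ha hb hc hau hbu hcu]
  exact R.base_mem_level hu

theorem exists_vertex {C : Set P} (hC : C ∈ L.Circles) (hpC : p ∉ C) :
    ∃ z, ¬ L.Par p z ∧ z ∈ C ∧ L.level p K z ∩ C = {z} := by
  obtain ⟨N, ⟨hN, z, hz⟩, -⟩ := R.vertex C hC hpC
  have hzC : z ∈ C ∩ N := hz ▸ rfl
  have hpz : ¬ L.Par p z := fun h => hpC
    (eq_of_par (R.pencil_circle hN) (R.base_mem_pencil hN) hzC.2 h ▸ hzC.1)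
  exact ⟨z, hpz, hzC.1, by rw [R.level_eq hpz hN hzC.2, Set.inter_comm, hz]⟩

theorem exists_ne_mem_level {x y : P} {M : Set P} (hx : ¬ L.Par p x) (hy : ¬ L.Par p y)
    (hyx : y ≠ x) (hM : M ∈ L.Circles) (hyM : y ∈ M) (hMx : L.level p K x ∩ M = {x}) :
    ∃ z, z ≠ y ∧ z ∈ L.level p K y ∧ z ∈ M := by
  by_contra! H
  have hMy : M ∩ L.level p K y = {y} := by
    ext z
    constructor
    · rintro ⟨h1, h2⟩
      by_contra hne
      exact H z hne h2 h1
    · rintro rfl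
      exact ⟨hyM, R.self_mem_level hy⟩
  have h : L.level p K y = L.level p K x :=
    (R.vertex M hM (R.base_not_mem hx hMx)).unique ⟨R.level_mem_pencil hy, y, hMy⟩
      ⟨R.level_mem_pencil hx, x, by rw [Set.inter_comm, hMx]⟩
  have : y ∈ L.level p K x ∩ M := ⟨h ▸ R.self_mem_level hy, hyM⟩
  rw [hMx] at this
  exact hyx this

theorem involution_mem_level {σ : Equiv.Perm P} (hσ : σ ∈ Δ) {x : P} (hx : ¬ L.Par p x)
    (hσx : σ x = x) (hσσ : ∀ u, σ (σ u) = u) (hne : σ ≠ 1) {u : P} (hu : ¬ L.Par p u) :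
    σ u ∈ L.level p K u := by
  have key : ∀ {u}, ¬ L.Par p u → ¬ L.Par x u → σ u ∈ L.level p K u := by
    intro u hu hxu
    by_contra hlev
    have huσ : ¬ L.Par u (σ u) := fun h => hne (R.eq_one_of_fix hσ hx hu hxu hσx h)
    have hpσ : ¬ L.Par p (σ u) := by rwa [R.par_base_map hσ]
    have hxσ : ¬ L.Par x (σ u) := fun h => hxu (by
      rw [← hσx] at h
      exact (R.par_map hσ).1 h)
    obtain ⟨S, ⟨hS, hpS, huS, hσS⟩, -⟩ := L.joinCircle p u (σ u) hu huσ hpσ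
    have hinv : ∀ {w}, w ∈ S → σ w ∈ S := fun hw =>
      R.map_mem_of_three hσ hS (ne_of_not_par hu) (ne_of_not_par huσ) (ne_of_not_par hpσ)
        hpS huS hσS (by rwa [R.map_base hσ]) hσS (by rwa [hσσ]) hw
    obtain ⟨k, hxk, hkS⟩ := exists_par_mem hS x
    have hpk := not_par_of_par hx hxk
    have hku : ¬ L.Par k u := fun h => hxu (par_trans hxk h)
    have hkσ : ¬ L.Par k (σ u) := fun h => hxσ (par_trans hxk h)
    have hσk : σ k = k := by
      refine (eq_of_par hS hkS (hinv hkS) (par_trans (par_symm hxk) ?_)).symm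
      rw [← hσx]
      exact (R.par_map hσ).2 hxk
    by_cases h : u ∈ L.level p K k
    · have hSk : S = L.level p K k :=
        circle_ext hS (R.level_circle hpk) (ne_of_not_par hpk) (ne_of_not_par hku)
          (ne_of_not_par hu) hpS hkS huS (R.base_mem_level hpk) (R.self_mem_level hpk) h
      rw [R.level_eq_level hpk hu h, ← hSk] at hlev
      exact hlev hσS
    · obtain ⟨C, hC, huC, hCk⟩ := R.exists_touching hpk hku h
      have hkC : k ∈ L.level p K k ∩ C := hCk ▸ rfl
      have hCS : C = S := circle_ext hC hS (ne_of_not_par hku) (ne_of_not_par huσ)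
        (ne_of_not_par hkσ) hkC.2 huC (R.map_mem_of_touching hσ hpk hσk hC hCk huC) hkS huS hσS
      exact R.base_not_mem hpk hCk (hCS ▸ hpS)
  by_cases hxu : L.Par x u
  · obtain ⟨y, hpy, hxy⟩ := L.exists_not_par p x
    obtain ⟨k, hyk, hk⟩ := exists_par_mem (R.level_circle hu) y
    have hpk := not_par_of_par hpy hyk
    have h1 := R.level_eq_level hu hpk hk
    have h2 := R.map_mem_level hσ hpk (R.mem_level_symm hu hpk hk)
    rwa [R.level_eq_level hpk (by rwa [R.par_base_map hσ]) (key hpk (not_par_of_par hxy hyk)),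
      h1] at h2
  · exact key hu hxu

end IsResidual

/-- `ι` is the level preserving involution in `Δ` with centre `x`. -/
structure IsReflection {P : Type*} (L : LaguerrePlane P) (p : P) (K : Set P)
    (Δ : Subgroup (Equiv.Perm P)) (x : P) (ι : Equiv.Perm P) : Prop where
  center : ¬ L.Par p x
  mem : ι ∈ Δ
  map_center : ι x = x
  ne_one : ι ≠ 1
  mul_self : ι * ι = 1
  mem_level : ∀ u, ¬ L.Par p u → ι u ∈ L.level p K u

namespace IsReflection

variable {P : Type*} {L : LaguerrePlane P} {p : P} {K : Set P} {Δ : Subgroup (Equiv.Perm P)}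

theorem apply_apply {x : P} {ι : Equiv.Perm P}
    (h : L.IsReflection p K Δ x ι) (u : P) : ι (ι u) = u := by
  simpa using congrArg (· u) h.mul_self

theorem inv_eq {x : P} {ι : Equiv.Perm P}
    (h : L.IsReflection p K Δ x ι) : ι⁻¹ = ι :=
  inv_eq_of_mul_eq_one_left h.mul_self

end IsReflection

namespace IsResidual

variable {P : Type*} {L : LaguerrePlane P} {p : P} {K : Set P} {Δ : Subgroup (Equiv.Perm P)}
  (R : L.IsResidual p K Δ)

include R

theorem exists_isReflection {x : P} (hx : ¬ L.Par p x) : ∃ ι, L.IsReflection p K Δ x ι := by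
  obtain ⟨y, hy, hxy, hyx⟩ := R.exists_not_par_not_mem_level hx
  obtain ⟨M, hM, hyM, hMx⟩ := R.exists_touching hx hxy hyx
  have hpM := R.base_not_mem hx hMx
  obtain ⟨z, hzy, hzl, hzM⟩ := R.exists_ne_mem_level hx hy (ne_of_not_par hxy).symm hM hyM hMx
  have hz : ¬ L.Par p z := fun h => hpM
    (eq_of_par (R.level_circle hy) (R.base_mem_level hy) hzl h ▸ hzM)
  have hxM : x ∈ L.level p K x ∩ M := hMx ▸ rfl
  have hxz : ¬ L.Par x z := fun h => by
    rw [← eq_of_par hM hxM.2 hzM h] at hzl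
    exact hyx (R.mem_level_symm hy hx hzl)
  obtain ⟨σ, hσ, hσx, hσy⟩ := R.exists_stab_par hx hy hz hxy hxz
  have hinv : ∀ {u}, u ∈ M → σ u ∈ M := fun hu => R.map_mem_of_touching hσ hx hσx hM hMx hu
  replace hσy : σ y = z := eq_of_par hM (hinv hyM) hzM hσy
  have hσz : σ z = y := by
    have h1 := R.map_mem_level hσ hy hzl
    rw [hσy, R.level_eq_level hy hz hzl] at h1
    refine (R.eq_or_eq_of_mem_level hM hpM hy hzy.symm hyM hzM (hinv hzM) (R.self_mem_level hy)
      hzl h1).resolve_right fun h => hzy ?_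
    exact σ.injective (h.trans hσy.symm)
  have hσσ : σ * σ = 1 := R.eq_one_of_fix (Δ.mul_mem hσ hσ) hx hy hxy
    (by simp [hσx]) (by simp [hσy, hσz, L.par_refl])
  have hne : σ ≠ 1 := by
    rintro rfl
    exact hzy hσy.symm
  exact ⟨σ, hx, hσ, hσx, hne, hσσ, fun u hu =>
    R.involution_mem_level hσ hx hσx (fun w => by simpa using congrArg (· w) hσσ) hne hu⟩

theorem par_of_par_reflection {x u : P} {ι : Equiv.Perm P} (h : L.IsReflection p K Δ x ι)
    (hu : ¬ L.Par p u) (hιu : L.Par u (ι u)) : L.Par x u := by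
  by_contra hxu
  exact h.ne_one (R.eq_one_of_fix h.mem h.center hu hxu h.map_center hιu)

theorem reflection_apply_of_par {x u : P} {ι : Equiv.Perm P} (h : L.IsReflection p K Δ x ι)
    (hxu : L.Par x u) : ι u = u := by
  have hu := not_par_of_par h.center hxu
  refine R.eq_of_par_of_mem_level hu (par_trans (par_symm hxu) ?_) (h.mem_level u hu)
  conv_lhs => rw [← h.map_center]
  exact (R.par_map h.mem).2 hxu

/-- The reflection at `k` is the only nontrivial level preserving element fixing `k`. -/
theorem eq_one_or_eq_reflection {k : P} {n ι : Equiv.Perm P} (h : L.IsReflection p K Δ k ι)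
    (hn : n ∈ Δ) (hnk : n k = k) (hlev : ∀ u, ¬ L.Par p u → n u ∈ L.level p K u) :
    n = 1 ∨ n = ι := by
  have hk := h.center
  obtain ⟨y, hy, hky, hyk⟩ := R.exists_not_par_not_mem_level hk
  obtain ⟨M, hM, hyM, hMk⟩ := R.exists_touching hk hky hyk
  have hιy : y ≠ ι y := fun h' =>
    hky (R.par_of_par_reflection h hy (by rw [← h']; exact L.par_refl y))
  rcases R.eq_or_eq_of_mem_level hM (R.base_not_mem hk hMk) hy hιy hyM
    (R.map_mem_of_touching h.mem hk h.map_center hM hMk hyM)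
    (R.map_mem_of_touching hn hk hnk hM hMk hyM) (R.self_mem_level hy) (h.mem_level y hy)
    (hlev y hy) with h1 | h1
  · exact Or.inl (R.eq_one_of_fix hn hk hy hky hnk (by rw [h1]; exact L.par_refl y))
  · right
    have : ι * n = 1 := R.eq_one_of_fix (Δ.mul_mem h.mem hn) hk hy hky
      (by simp [hnk, h.map_center]) (by simp [h1, h.apply_apply, L.par_refl])
    rw [← h.inv_eq, eq_inv_of_mul_eq_one_right this]

/-- If `e` fixes the generator of `x`, but none of its points, then `e` acts on generators
like the identity or like the reflection at `x`. -/
theorem par_or_par_reflection {e ι : Equiv.Perm P} {x y : P} (he : e ∈ Δ)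
    (h : L.IsReflection p K Δ x ι) (hex : L.Par x (e x)) (hne : ∀ u, L.Par x u → e u ≠ u)
    (hy : ¬ L.Par p y) (hxy : ¬ L.Par x y) : L.Par y (e y) ∨ L.Par (ι y) (e y) := by
  by_contra! H
  have hx := h.center
  have hιy : ¬ L.Par y (ι y) := fun h' => hxy (R.par_of_par_reflection h hy h')
  have hpι : ¬ L.Par p (ι y) := by rwa [R.par_base_map h.mem]
  have hpe : ¬ L.Par p (e y) := by rwa [R.par_base_map he]
  obtain ⟨C, ⟨hC, hyC, hιC, heC⟩, -⟩ := L.joinCircle y (ι y) (e y) hιy H.2 H.1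
  by_cases hpC : p ∈ C
  · have hCy : C = L.level p K y := circle_ext hC (R.level_circle hy) (ne_of_not_par hy)
      (ne_of_not_par hιy) (ne_of_not_par hpι) hpC hyC hιC (R.base_mem_level hy)
      (R.self_mem_level hy) (h.mem_level y hy)
    rw [hCy] at heC
    obtain ⟨t, hxt, ht⟩ := exists_par_mem (R.level_circle hy) x
    have het := R.map_mem_level he hy ht
    rw [R.level_eq_level hy hpe heC] at het
    refine hne t hxt (eq_of_par (R.level_circle hy) het ht ?_)
    exact par_trans (par_symm ((R.par_map he).2 hxt)) (par_trans (par_symm hex) hxt)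
  · obtain ⟨z, hz, hzC, hCz⟩ := R.exists_vertex hC hpC
    obtain ⟨q, hpq, hqC⟩ := exists_par_mem hC p
    have hqX : ∀ {w}, ¬ L.Par p w → q ≠ w := by
      rintro w hw rfl
      exact hw hpq
    have hιz : ι z ∈ L.level p K z ∩ C := ⟨h.mem_level z hz,
      R.map_mem_of_three h.mem hC (hqX hy) (ne_of_not_par hιy) (hqX hpι) hqC hyC hιC
        (by rwa [R.fix ι h.mem q hpq]) hιC (by rwa [h.apply_apply]) hzC⟩
    rw [hCz] at hιz
    have hxz : L.Par x z := R.par_of_par_reflection h hz (by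
      rw [Set.mem_singleton_iff.1 hιz]; exact L.par_refl z)
    have hzy : ¬ L.Par z y := fun h' => hxy (par_trans hxz h')
    have hze : ¬ L.Par z (e y) := fun h' => hxy ((R.par_map he).1
      (par_trans (par_symm hex) (par_trans hxz h')))
    obtain ⟨s, hs, hsz, hsy⟩ := R.exists_stab_par hz hy hpe hzy hze
    replace hsy : s y = e y :=
      eq_of_par hC (R.map_mem_of_touching hs hz hsz hC hCz hyC) heC hsy
    have hse : s⁻¹ * e = 1 := by
      refine R.eq_one_of_fix (Δ.mul_mem (Δ.inv_mem hs) he) hy hx (fun h' => hxy (par_symm h'))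
        (by simp [← hsy]) ?_
      rw [← R.par_map hs]
      have h1 : L.Par (s x) z := by
        conv_rhs => rw [← hsz]
        exact (R.par_map hs).2 hxz
      simpa using par_trans h1 (par_trans (par_symm hxz) hex)
    rw [inv_mul_eq_one] at hse
    exact hne z hxz (hse ▸ hsz)

theorem eq_one_of_vertical {v : Equiv.Perm P} (hv : v ∈ Δ) (hpar : ∀ u, L.Par u (v u)) {x : P}
    (hx : ¬ L.Par p x) (hvx : v x = x) : v = 1 := by
  obtain ⟨y, hy, hxy⟩ := L.exists_not_par p x
  exact R.eq_one_of_fix hv hx hy hxy hvx (hpar y)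

/-- The elements of `Δ` preserving all generators act transitively on each generator. -/
theorem exists_vertical {x x' : P} (hx : ¬ L.Par p x) (hxx' : L.Par x x') :
    ∃ v ∈ Δ, v x = x' ∧ ∀ u, L.Par u (v u) := by
  by_cases heq : x = x'
  · exact ⟨1, Δ.one_mem, heq, L.par_refl⟩
  obtain ⟨y, hy, hxy⟩ := L.exists_not_par p x
  have hx' := not_par_of_par hx hxx'
  obtain ⟨g, hg, rfl⟩ := R.trans x x' hx hx'
  obtain ⟨s, hs, hsx, hsy⟩ := R.exists_stab_par hx' (y := g y) (by rwa [R.par_base_map hg]) hy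
    (by rwa [R.par_map hg]) (fun h => hxy (par_trans hxx' h))
  obtain ⟨e, he, hex, hey⟩ : ∃ e ∈ Δ, e x = g x ∧ L.Par y (e y) :=
    ⟨s * g, Δ.mul_mem hs hg, hsx, par_symm hsy⟩
  have hex' : L.Par x (e x) := hex ▸ hxx'
  have hne : e ≠ 1 := by
    rintro rfl
    exact heq hex
  have hnx : ∀ u, L.Par x u → e u ≠ u := fun u hu h => hne
    (R.eq_one_of_fix he (not_par_of_par hx hu) hy (fun h' => hxy (par_trans hu h')) h hey)
  have hny : ∀ u, L.Par y u → e u ≠ u := fun u hu h => hne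
    (R.eq_one_of_fix he (not_par_of_par hy hu) hx
      (fun h' => hxy (par_symm (par_trans hu h'))) h hex')
  refine ⟨e, he, hex, fun u => ?_⟩
  by_cases hpu : L.Par p u
  · rw [R.fix e he u hpu]
    exact L.par_refl u
  by_cases hxu : L.Par x u
  · exact par_trans (par_symm hxu) (par_trans hex' ((R.par_map he).2 hxu))
  by_cases hyu : L.Par y u
  · exact par_trans (par_symm hyu) (par_trans hey ((R.par_map he).2 hyu))
  obtain ⟨ι, hι⟩ := R.exists_isReflection hx
  obtain ⟨κ, hκ⟩ := R.exists_isReflection hy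
  by_contra hu
  have h1 := (R.par_or_par_reflection he hι hex' hnx hpu hxu).resolve_left hu
  have h2 := (R.par_or_par_reflection he hκ hey hny hpu hyu).resolve_left hu
  have hικ : ι u = κ u := eq_of_par (R.level_circle hpu) (hι.mem_level u hpu)
    (hκ.mem_level u hpu) (par_trans h1 (par_symm h2))
  have hone : κ⁻¹ * ι = 1 := by
    refine R.eq_one_of_fix (Δ.mul_mem (Δ.inv_mem hκ.mem) hι.mem) hpu (y := ι u)
      (by rwa [R.par_base_map hι.mem]) (fun h => hxu (R.par_of_par_reflection hι hpu h))
      (by simp [hικ]) ?_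
    rw [hκ.inv_eq, Equiv.Perm.mul_apply, hι.apply_apply, hικ]
    exact L.par_refl _
  rw [inv_mul_eq_one] at hone
  refine hxy (R.par_of_par_reflection hι hy ?_)
  rw [← hone, hκ.map_center]
  exact L.par_refl y

theorem commute_of_level_of_vertical {n v : Equiv.Perm P} (hn : n ∈ Δ) (hv : v ∈ Δ)
    (hlev : ∀ u, ¬ L.Par p u → n u ∈ L.level p K u) (hpar : ∀ u, L.Par u (v u)) :
    Commute n v := by
  ext u
  by_cases hu : L.Par p u
  · simp [R.fix n hn u hu, R.fix v hv u hu]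
  · have hvu : ¬ L.Par p (v u) := by rwa [R.par_base_map hv]
    exact eq_of_par (R.level_circle hvu) (hlev _ hvu) (R.map_mem_level hv hu (hlev u hu))
      (par_trans ((R.par_map hn).2 (par_symm (hpar u))) (hpar (n u)))

theorem exists_reflection_apply {x z : P} (hx : ¬ L.Par p x) (hz : ¬ L.Par p z)
    (hzx : z ∈ L.level p K x) : ∃ m ι, L.IsReflection p K Δ m ι ∧ ι x = z := by
  by_cases hne : z = x
  · obtain ⟨ι, hι⟩ := R.exists_isReflection hx
    exact ⟨x, ι, hι, hι.map_center.trans hne.symm⟩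
  have hxz : ¬ L.Par x z := fun h => hne (R.eq_of_par_of_mem_level hx h hzx)
  obtain ⟨y, hy, hxy, hyx⟩ := R.exists_not_par_not_mem_level hx
  obtain ⟨M, hM, -, hMx⟩ := R.exists_touching hx hxy hyx
  obtain ⟨q, hpq, hqM⟩ := exists_par_mem hM p
  have hqp : p ≠ q := fun h => R.base_not_mem hx hMx (h ▸ hqM)
  obtain ⟨C, ⟨hC, hxC, hzC, hqC⟩, -⟩ := L.joinCircle x z q hxz
    (fun h => hz (par_trans hpq (par_symm h))) (fun h => hx (par_trans hpq (par_symm h)))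
  have hpC : p ∉ C := fun h => hqp (eq_of_par hC h hqC hpq)
  obtain ⟨m, hm, hmC, hCm⟩ := R.exists_vertex hC hpC
  obtain ⟨ι, hι⟩ := R.exists_isReflection hm
  refine ⟨m, ι, hι, (R.eq_or_eq_of_mem_level hC hpC hx (Ne.symm hne) hxC hzC
    (R.map_mem_of_touching hι.mem hm hι.map_center hC hCm hxC) (R.self_mem_level hx) hzx
    (hι.mem_level x hx)).resolve_left fun h => hne ?_⟩
  have hmx : m = x := eq_of_par hC hmC hxC
    (R.par_of_par_reflection hι hx (by rw [h]; exact L.par_refl x))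
  subst hmx
  have : z ∈ L.level p K m ∩ C := ⟨hzx, hzC⟩
  rwa [hCm] at this

theorem mul_mem_level {a b : Equiv.Perm P} (hb : b ∈ Δ)
    (hla : ∀ u, ¬ L.Par p u → a u ∈ L.level p K u) (hlb : ∀ u, ¬ L.Par p u → b u ∈ L.level p K u)
    (u : P) (hu : ¬ L.Par p u) : (a * b) u ∈ L.level p K u := by
  have hbu : ¬ L.Par p (b u) := by rwa [R.par_base_map hb]
  have := hla _ hbu
  rwa [R.level_eq_level hu hbu (hlb u hu)] at this

/-- A product of reflections at nonparallel points has no fixed points. -/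
theorem reflection_mul_apply_ne {m x u : P} {a b : Equiv.Perm P} (ha : L.IsReflection p K Δ m a)
    (hb : L.IsReflection p K Δ x b) (hmx : ¬ L.Par m x) (hu : ¬ L.Par p u) : (a * b) u ≠ u := by
  intro h
  obtain ⟨c, hc⟩ := R.exists_isReflection hu
  rcases R.eq_one_or_eq_reflection hc (Δ.mul_mem ha.mem hb.mem) h
    (R.mul_mem_level hb.mem ha.mem_level hb.mem_level) with h1 | h1
  · refine hmx (R.par_of_par_reflection ha hb.center ?_)
    rw [← ha.inv_eq, inv_eq_of_mul_eq_one_right h1, hb.map_center]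
    exact L.par_refl x
  · have h2 : (a * b) ((a * b) x) = x := by
      rw [h1]
      exact hc.apply_apply x
    simp only [Equiv.Perm.mul_apply, hb.map_center] at h2
    have h3 : b (a x) = a x := a.injective (h2.trans (ha.apply_apply x).symm)
    have hpa : ¬ L.Par p (a x) := by
      rw [R.par_base_map ha.mem]
      exact hb.center
    exact hmx (R.par_of_par_reflection ha hb.center
      (R.par_of_par_reflection hb hpa (by rw [h3]; exact L.par_refl _)))

theorem reflection_mul_mul {m x k : P} {a b c : Equiv.Perm P} (ha : L.IsReflection p K Δ m a)
    (hb : L.IsReflection p K Δ x b) (hc : L.IsReflection p K Δ k c) : a * b * c = c * b * a := by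
  by_cases hmx : L.Par m x
  · have hab : a = b := (R.eq_one_or_eq_reflection hb ha.mem (R.reflection_apply_of_par ha hmx)
      ha.mem_level).resolve_left ha.ne_one
    subst hab
    rw [mul_assoc c, ha.mul_self, one_mul, mul_one]
  have hlev := R.mul_mem_level hb.mem ha.mem_level hb.mem_level
  have hab := Δ.mul_mem ha.mem hb.mem
  obtain ⟨j, d, hd, hdk⟩ := R.exists_reflection_apply hc.center (z := (a * b) k)
    (by rw [R.par_base_map hab]; exact hc.center) (hlev k hc.center)
  rcases R.eq_one_or_eq_reflection hc (n := d * (a * b)) (Δ.mul_mem hd.mem hab)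
    (by rw [Equiv.Perm.mul_apply, ← hdk, hd.apply_apply])
    (R.mul_mem_level hab hd.mem_level hlev) with h1 | h1
  · refine absurd ?_ (R.reflection_mul_apply_ne ha hb hmx hd.center)
    rw [← inv_eq_of_mul_eq_one_right h1, hd.inv_eq, hd.map_center]
  · have h2 : a * b * c = d := by
      have h3 : a * b = d * c := by rw [← h1, ← mul_assoc d d, hd.mul_self, one_mul]
      rw [h3, mul_assoc, hc.mul_self, mul_one]
    rw [h2, ← hd.inv_eq, ← h2]
    simp only [mul_inv_rev, ha.inv_eq, hb.inv_eq, hc.inv_eq, mul_assoc]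

theorem commute_reflection_mul {m m' x : P} {a a' b : Equiv.Perm P}
    (ha : L.IsReflection p K Δ m a) (ha' : L.IsReflection p K Δ m' a')
    (hb : L.IsReflection p K Δ x b) : Commute (a * b) (a' * b) := by
  change a * b * (a' * b) = a' * b * (a * b)
  rw [← mul_assoc, ← mul_assoc, R.reflection_mul_mul ha hb ha']

/-- Along a fixed circle through the base point, each generator preserving element can be
compensated by a level preserving one. -/
theorem exists_reflection_preserving {T : Set P} (hT : T ∈ L.Circles) (hpT : p ∈ T) {x t : P}
    (hxT : x ∈ T) (htT : t ∈ T) (hx : ¬ L.Par p x) (htx : t ∉ L.level p K x)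
    {b : Equiv.Perm P} (hb : L.IsReflection p K Δ x b) {v : Equiv.Perm P} (hv : v ∈ Δ)
    (hpar : ∀ u, L.Par u (v u)) :
    ∃ m a, L.IsReflection p K Δ m a ∧ ∀ u ∈ T, (b * a * v) u ∈ T := by
  by_cases hv1 : v = 1
  · subst hv1
    exact ⟨x, b, hb, fun u hu => by simpa [hb.mul_self] using hu⟩
  have hvT := R.image_circle hv hT
  have hpv : p ∈ ⇑v '' T := ⟨p, hpT, R.map_base hv⟩
  have hint : ⇑v '' T ∩ T = {p} := by
    refine Set.Subset.antisymm ?_ (Set.singleton_subset_iff.2 ⟨hpv, hpT⟩)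
    rintro _ ⟨⟨w, hw, rfl⟩, hwT⟩
    have h1 : v w = w := (eq_of_par hT hw hwT (hpar w)).symm
    have h2 : L.Par p w := by
      by_contra h
      exact hv1 (R.eq_one_of_vertical hv hpar h h1)
    rw [h1]
    exact (eq_of_par hT hpT hw h2).symm
  have hxv : x ∉ ⇑v '' T := fun h => by
    have : x ∈ ⇑v '' T ∩ T := ⟨h, hxT⟩
    rw [hint] at this
    exact hx (this ▸ L.par_refl p)
  have hl := R.level_circle hx
  obtain ⟨r, hrv, hrl, hrp⟩ : ∃ r ∈ ⇑v '' T, r ∈ L.level p K x ∧ r ≠ p := by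
    by_contra! H
    have h1 : ⇑v '' T ∩ L.level p K x = {p} :=
      Set.Subset.antisymm (fun r hr => H r hr.1 hr.2)
        (Set.singleton_subset_iff.2 ⟨hpv, R.base_mem_level hx⟩)
    rw [touching_ext hvT hxv hT hl hxT (R.self_mem_level hx) hint h1] at htT
    exact htx htT
  have hr : ¬ L.Par p r := fun h => hrp (eq_of_par hvT hpv hrv h).symm
  obtain ⟨m, a, ha, hax⟩ := R.exists_reflection_apply hx hr hrl
  have hrx : r ≠ x := fun h => hxv (h ▸ hrv)
  have hmx : ¬ L.Par m x := fun h => hrx (hax.symm.trans (R.reflection_apply_of_par ha h))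
  have hba := Δ.mul_mem hb.mem ha.mem
  have hint' : ⇑v '' T ∩ ⇑(b * a) '' (⇑v '' T) = {p} := by
    refine Set.Subset.antisymm ?_
      (Set.singleton_subset_iff.2 ⟨hpv, p, hpv, R.map_base hba⟩)
    rintro _ ⟨hw', ⟨w, hw, rfl⟩⟩
    by_cases hpw : L.Par p w
    · rw [R.fix _ hba w hpw]
      exact (eq_of_par hvT hpv hw hpw).symm
    · have hpw' : ¬ L.Par p ((b * a) w) := by rwa [R.par_base_map hba]
      have hvl : ⇑v '' T = L.level p K w :=
        circle_ext hvT (R.level_circle hpw) (ne_of_not_par hpw)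
          (R.reflection_mul_apply_ne hb ha (fun h => hmx (par_symm h)) hpw).symm
          (ne_of_not_par hpw') hpv hw hw' (R.base_mem_level hpw) (R.self_mem_level hpw)
          (R.mul_mem_level ha.mem hb.mem_level ha.mem_level w hpw)
      refine absurd ?_ hxv
      rw [hvl] at hrv ⊢
      rw [← R.level_eq_level hpw hr hrv]
      exact R.mem_level_symm hx hr hrl
  have hxba : x ∈ ⇑(b * a) '' (⇑v '' T) := ⟨r, hrv, by
    rw [Equiv.Perm.mul_apply, ← hax, ha.apply_apply, hb.map_center]⟩
  have h := touching_ext hvT hxv (R.image_circle hba hvT) hT hxba hxT hint' hint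
  exact ⟨m, a, ha, fun u hu => h ▸ ⟨v u, ⟨u, hu, rfl⟩, rfl⟩⟩

theorem commute_vertical {v w : Equiv.Perm P} (hv : v ∈ Δ) (hw : w ∈ Δ)
    (hvpar : ∀ u, L.Par u (v u)) (hwpar : ∀ u, L.Par u (w u)) {x : P} (hx : ¬ L.Par p x) :
    Commute v w := by
  obtain ⟨t, ht, hxt, htx⟩ := R.exists_not_par_not_mem_level hx
  obtain ⟨T, ⟨hT, hpT, hxT, htT⟩, -⟩ := L.joinCircle p x t hx hxt ht
  obtain ⟨b, hb⟩ := R.exists_isReflection hx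
  obtain ⟨m, a, ha, hTa⟩ := R.exists_reflection_preserving hT hpT hxT htT hx htx hb hv hvpar
  obtain ⟨n, c, hc, hTc⟩ := R.exists_reflection_preserving hT hpT hxT htT hx htx hb hw hwpar
  have hac : Commute (b * a) (b * c) := by
    have := (R.commute_reflection_mul ha hc hb).inv_inv
    simpa [mul_inv_rev, ha.inv_eq, hb.inv_eq, hc.inv_eq] using this
  have hvc : Commute (b * c) v := R.commute_of_level_of_vertical (Δ.mul_mem hb.mem hc.mem) hv
    (R.mul_mem_level hc.mem hb.mem_level hc.mem_level) hvpar
  have hwa : Commute (b * a) w := R.commute_of_level_of_vertical (Δ.mul_mem hb.mem ha.mem) hw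
    (R.mul_mem_level ha.mem hb.mem_level ha.mem_level) hwpar
  have e1 : b * a * v * (b * c * w) = b * a * (b * c) * (v * w) := by
    rw [mul_assoc (b * a), ← mul_assoc v, ← hvc.eq]
    simp only [mul_assoc]
  have e2 : b * c * w * (b * a * v) = b * a * (b * c) * (w * v) := by
    rw [hac.eq, mul_assoc (b * c), ← mul_assoc w, ← hwa.eq]
    simp only [mul_assoc]
  have hg : b * a * (b * c) ∈ Δ :=
    Δ.mul_mem (Δ.mul_mem hb.mem ha.mem) (Δ.mul_mem hb.mem hc.mem)
  have h1 := hTa _ (hTc x hxT)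
  have h2 := hTc _ (hTa x hxT)
  rw [← Equiv.Perm.mul_apply, e1, Equiv.Perm.mul_apply] at h1
  rw [← Equiv.Perm.mul_apply, e2, Equiv.Perm.mul_apply] at h2
  have hvw : ∀ u, L.Par u ((v * w) u) := fun u => par_trans (hwpar u) (hvpar (w u))
  have hwv : ∀ u, L.Par u ((w * v) u) := fun u => par_trans (hvpar u) (hwpar (v u))
  have h3 : (v * w) x = (w * v) x := (b * a * (b * c)).injective
    (eq_of_par hT h1 h2 ((R.par_map hg).2 (par_trans (par_symm (hvw x)) (hwv x))))
  have hwvm := Δ.mul_mem hw hv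
  have h4 : (w * v)⁻¹ * (v * w) = 1 := by
    refine R.eq_one_of_vertical (Δ.mul_mem (Δ.inv_mem hwvm) (Δ.mul_mem hv hw)) (fun u => ?_) hx
      (by rw [Equiv.Perm.mul_apply, h3, ← Equiv.Perm.mul_apply, inv_mul_cancel, Equiv.Perm.one_apply])
    rw [← R.par_map hwvm]
    have := par_trans (par_symm (hwv u)) (hvw u)
    rwa [← Equiv.Perm.mul_apply, mul_inv_cancel_left]
  exact (inv_mul_eq_one.1 h4).symm

/-- The translations `a * b * v`, with `b` the reflection at `x`, act transitively. -/
theorem exists_translation {x y : P} (hy : ¬ L.Par p y) {b : Equiv.Perm P}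
    (hb : L.IsReflection p K Δ x b) :
    ∃ m a v, L.IsReflection p K Δ m a ∧ v ∈ Δ ∧ (∀ u, L.Par u (v u)) ∧ (a * b * v) x = y := by
  have hx := hb.center
  obtain ⟨s, hxs, hs⟩ := exists_par_mem (R.level_circle hy) x
  obtain ⟨t, hyt, ht⟩ := exists_par_mem (R.level_circle hx) y
  have hps := not_par_of_par hx hxs
  have hpt := not_par_of_par hy hyt
  obtain ⟨v, hv, hvx, hpar⟩ := R.exists_vertical hx hxs
  obtain ⟨m, a, ha, hax⟩ := R.exists_reflection_apply hx hpt ht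
  refine ⟨m, a, v, ha, hv, hpar, ?_⟩
  have hcomm : a * b * v = v * (a * b) :=
    R.commute_of_level_of_vertical (Δ.mul_mem ha.mem hb.mem) hv
      (R.mul_mem_level hb.mem ha.mem_level hb.mem_level) hpar
  rw [hcomm, Equiv.Perm.mul_apply, Equiv.Perm.mul_apply, hb.map_center, hax]
  have h1 := R.map_mem_level hv hx ht
  rw [hvx, R.level_eq_level hy hps hs] at h1
  exact R.eq_of_par_of_mem_level hy (par_trans hyt (hpar t)) h1

theorem commute_translation {x m n : P} {a b c v w : Equiv.Perm P}
    (ha : L.IsReflection p K Δ m a) (hb : L.IsReflection p K Δ x b)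
    (hc : L.IsReflection p K Δ n c) (hv : v ∈ Δ) (hw : w ∈ Δ) (hvpar : ∀ u, L.Par u (v u))
    (hwpar : ∀ u, L.Par u (w u)) : Commute (a * b * v) (c * b * w) := by
  have hlev : ∀ {k d}, L.IsReflection p K Δ k d → ∀ {u}, u ∈ Δ → (∀ q, L.Par q (u q)) →
      Commute (d * b) u := fun hd _ hu hpar =>
    R.commute_of_level_of_vertical (Δ.mul_mem hd.mem hb.mem) hu
      (R.mul_mem_level hb.mem hd.mem_level hb.mem_level) hpar
  exact Commute.mul_left
    ((R.commute_reflection_mul ha hc hb).mul_right (hlev ha hw hwpar))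
    ((hlev hc hv hvpar).symm.mul_right (R.commute_vertical hv hw hvpar hwpar hb.center))

end IsResidual

theorem image_line {P : Type*} {Δ : Subgroup (Equiv.Perm P)} {σ : Equiv.Perm P} (hσ : σ ∈ Δ)
    (x y : P) : ⇑σ '' line Δ x y = line Δ (σ x) (σ y) := by
  ext w
  constructor
  · rintro ⟨u, rfl | ⟨τ, hτ, hτx, rfl⟩, rfl⟩
    · exact Or.inl rfl
    · exact Or.inr ⟨σ * τ * σ⁻¹, Δ.mul_mem (Δ.mul_mem hσ hτ) (Δ.inv_mem hσ), by simp [hτx],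
        by simp⟩
  · rintro (rfl | ⟨τ, hτ, hτx, rfl⟩)
    · exact ⟨x, Or.inl rfl, rfl⟩
    · exact ⟨σ⁻¹ (τ (σ y)), Or.inr ⟨σ⁻¹ * τ * σ, Δ.mul_mem (Δ.mul_mem (Δ.inv_mem hσ) hτ) hσ,
        by simp [hτx], by simp⟩, by simp⟩

end LaguerrePlane

/-- assume (A3).  SA(p,K) satisfies the parallelogram condition
(Pgm): for pairwise distinct x, y, z ∈ P ∖ p̄ there is w ∈ P ∖ p̄ with
x⊔y ∥ z⊔w and x⊔z ∥ y⊔w. -/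
theorem parallelogram_condition
    {P : Type*} (L : LaguerrePlane P) (p : P) (K : Set P)
    (Δ : Subgroup (Equiv.Perm P))
    (hK : K ∈ L.Circles) (hpK : p ∈ K)
    (haut : ∀ σ ∈ Δ, L.IsAut σ)
    (hfix : ∀ σ ∈ Δ, ∀ q, L.Par p q → σ q = q)
    (hpen : ∀ σ ∈ Δ, ∀ M ∈ L.pencil p K, ⇑σ '' M ∈ L.pencil p K)
    (hA1 : ∀ x y : P, ¬ L.Par p x → ¬ L.Par p y → ∃ σ ∈ Δ, σ x = y)
    (hA2 : ∀ r ∈ K, r ≠ p → ∀ x ∈ K, x ≠ p → x ≠ r → ∀ y ∈ K, y ≠ p → y ≠ r →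
      ∃ σ ∈ Δ, σ r = r ∧ σ x = y)    (hA3 : ∀ M ∈ L.Circles, p ∉ M → ∃! N, N ∈ L.pencil p K ∧ ∃ z, M ∩ N = {z})    :
    ∀ x y z : P, ¬ L.Par p x → ¬ L.Par p y → ¬ L.Par p z →
    x ≠ y → x ≠ z → y ≠ z →
    ∃ w : P, ¬ L.Par p w ∧ LinePar Δ (line Δ x y) (line Δ z w) ∧
      LinePar Δ (line Δ x z) (line Δ y w) := by
  intro x y z hx hy hz _ _ _
  have R : L.IsResidual p K Δ := ⟨hK, hpK, haut, hfix, hpen, hA1, hA2, hA3⟩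
  obtain ⟨b, hb⟩ := R.exists_isReflection hx
  obtain ⟨m, a, v, ha, hv, hvpar, hay⟩ := R.exists_translation hy hb
  obtain ⟨n, c, w, hc, hw, hwpar, hcz⟩ := R.exists_translation hz hb
  have hcomm := R.commute_translation ha hb hc hv hw hvpar hwpar
  have hav := Δ.mul_mem (Δ.mul_mem ha.mem hb.mem) hv
  have hcw := Δ.mul_mem (Δ.mul_mem hc.mem hb.mem) hw
  refine ⟨(c * b * w) y, by rwa [R.par_base_map hcw], ⟨c * b * w, hcw, ?_⟩,
    ⟨a * b * v, hav, ?_⟩⟩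
  · rw [image_line hcw, hcz]
  · rw [image_line hav, hay, ← hcz, ← hay, ← Equiv.Perm.mul_apply, ← Equiv.Perm.mul_apply,
      hcomm.eq]
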